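/- arXiv:2109.12362 — 2 statements merged into one kernel-verified Lean document; each statement's English description precedes it below -/
import Mathlib

section
/- Let q be a nonzero real number, let α > 0, and let f : ℝ → ℝ be twice differentiable on a neighborhood of α with f'(α) ≠ 0 and f''(α) ≠ 0, and set g(t) = f(t^(1/q)) for t > 0. If 0 < 1 + (f'(α)/f''(α))·(1-q)/α ≤ 1 then g''(α^q)·f''(α) > 0 (the curves g near α^q and f near α have the same convexity), while if -1 ≤ 1 + (f'(α)/f''(α))·(1-q)/α < 0 then g''(α^q)·f''(α) < 0 (opposite convexity). -/
open Real

/-- The second derivative of `t ↦ f (t ^ p)` at a point `x > 0`. -/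
theorem deriv_deriv_comp_rpow {f : ℝ → ℝ} {p x : ℝ} (hx : 0 < x)
    (hf : ∀ᶠ y in nhds (x ^ p), DifferentiableAt ℝ f y)
    (hf2 : DifferentiableAt ℝ (deriv f) (x ^ p)) :
    deriv (deriv (fun t : ℝ => f (t ^ p))) x =
      (p * x ^ p / x) ^ 2 * deriv (deriv f) (x ^ p) +
        p * (p - 1) * x ^ p / x ^ 2 * deriv f (x ^ p) := by
  have hpow : ∀ (r : ℝ) {t : ℝ}, 0 < t → HasDerivAt (fun t : ℝ => t ^ r) (r * t ^ (r - 1)) t :=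
    fun r t ht => Real.hasDerivAt_rpow_const (Or.inl ht.ne')
  have hfirst : deriv (fun t : ℝ => f (t ^ p)) =ᶠ[nhds x]
      fun t => deriv f (t ^ p) * (p * t ^ (p - 1)) := by
    filter_upwards [(hpow p hx).continuousAt.eventually hf, eventually_gt_nhds hx] with t htf ht
    exact (htf.hasDerivAt.comp t (hpow p ht)).deriv
  have hsecond : HasDerivAt (fun t : ℝ => deriv f (t ^ p) * (p * t ^ (p - 1))) _ x :=
    (hf2.hasDerivAt.comp x (hpow p hx)).mul ((hpow (p - 1) hx).const_mul p)
  rw [hfirst.deriv_eq, hsecond.deriv]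
  simp only [Function.comp_apply, Real.rpow_sub_one hx.ne']
  field_simp

/-- Theorem 4.4: if `0 < 1 + (f'(α)/f''(α))·(1-q)/α ≤ 1` then `g` near `α^q` and `f`
near `α` have the same convexity (`g''(α^q)·f''(α) > 0`), while if
`-1 ≤ 1 + (f'(α)/f''(α))·(1-q)/α < 0` they have opposite convexity. -/
theorem convexity_comparison (q α : ℝ) (hq : q ≠ 0) (hα : 0 < α)
    (f : ℝ → ℝ) (s : Set ℝ) (hs : s ∈ nhds α)
    (hf : ∀ y ∈ s, DifferentiableAt ℝ f y)
    (hf2 : ∀ y ∈ s, DifferentiableAt ℝ (deriv f) y)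
    (hf' : deriv f α ≠ 0) (hf'' : deriv (deriv f) α ≠ 0) :
    ((0 < 1 + deriv f α / deriv (deriv f) α * ((1 - q) / α) ∧
        1 + deriv f α / deriv (deriv f) α * ((1 - q) / α) ≤ 1) →
      0 < deriv (deriv (fun t : ℝ => f (t ^ (1 / q)))) (α ^ q) * deriv (deriv f) α) ∧
    ((-1 ≤ 1 + deriv f α / deriv (deriv f) α * ((1 - q) / α) ∧
        1 + deriv f α / deriv (deriv f) α * ((1 - q) / α) < 0) →
      deriv (deriv (fun t : ℝ => f (t ^ (1 / q)))) (α ^ q) * deriv (deriv f) α < 0) := by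
  have hx : 0 < α ^ q := Real.rpow_pos_of_pos hα q
  have hroot : (α ^ q) ^ (1 / q) = α := by
    rw [← Real.rpow_mul hα.le, mul_one_div_cancel hq, Real.rpow_one]
  have hfactor : deriv (deriv (fun t : ℝ => f (t ^ (1 / q)))) (α ^ q) * deriv (deriv f) α =
      (α / (q * α ^ q) * deriv (deriv f) α) ^ 2 *
        (1 + deriv f α / deriv (deriv f) α * ((1 - q) / α)) := by
    rw [deriv_deriv_comp_rpow hx (by rw [hroot]; filter_upwards [hs] using hf)
      (by rw [hroot]; exact hf2 α (mem_of_mem_nhds hs)), hroot]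
    field_simp
  have hpos : 0 < (α / (q * α ^ q) * deriv (deriv f) α) ^ 2 := by positivity
  rw [hfactor]
  exact ⟨fun h => mul_pos hpos h.1, fun h => mul_neg_of_pos_of_neg hpos h.2⟩
end

section
/- Let q be a nonzero real number, let α > 0, and let f : ℝ → ℝ be twice differentiable on a neighborhood of α with f'(α) ≠ 0 and f''(α) ≠ 0. Set g(t) = f(t^(1/q)) for t > 0, μ(α) = f''(α)/(1 + f'(α)²)^(3/2), and μ_q(α^q) = g''(α^q)/(1 + g'(α^q)²)^(3/2). If |μ_q(α^q)| ≤ |μ(α)| and (q·α^(q-1))²·(1 + (f'(α)/(q·α^(q-1)))²)^(3/2) ≤ (1 + f'(α)²)^(3/2), then |1 + (f'(α)/f''(α))·(1-q)/α| ≤ 1 (equivalently, 0 ≤ (f'(α)/f''(α))·(q-1)/α ≤ 2). -/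
open Real

theorem deriv_comp_rpow_one_div_eventuallyEq {q α : ℝ} (hq : q ≠ 0) (hα : 0 < α) {f : ℝ → ℝ}
    (hf : ∀ᶠ y in nhds α, DifferentiableAt ℝ f y) :
    deriv (fun t : ℝ => f (t ^ (1 / q))) =ᶠ[nhds (α ^ q)]
      fun t => deriv f (t ^ (1 / q)) * (1 / q * t ^ (1 / q - 1)) := by
  have hpos : 0 < α ^ q := rpow_pos_of_pos hα q
  have hroot : (α ^ q) ^ (1 / q) = α := by
    rw [← rpow_mul hα.le, mul_one_div_cancel hq, rpow_one]
  have hcont : Filter.Tendsto (fun t : ℝ => t ^ (1 / q)) (nhds (α ^ q)) (nhds α) := by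
    have h := (continuousAt_rpow_const (α ^ q) (1 / q) (Or.inl hpos.ne')).tendsto
    rwa [hroot] at h
  filter_upwards [hcont.eventually hf, lt_mem_nhds hpos] with t ht htpos
  exact (ht.hasDerivAt.comp t (hasDerivAt_rpow_const (Or.inl htpos.ne'))).deriv

theorem deriv_comp_rpow_one_div {q α : ℝ} (hq : q ≠ 0) (hα : 0 < α) {f : ℝ → ℝ}
    (hf : ∀ᶠ y in nhds α, DifferentiableAt ℝ f y) :
    deriv (fun t : ℝ => f (t ^ (1 / q))) (α ^ q) = deriv f α / (q * α ^ (q - 1)) := by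
  rw [(deriv_comp_rpow_one_div_eventuallyEq hq hα hf).eq_of_nhds]
  have hexp : q * (1 / q - 1) = -(q - 1) := by field_simp; ring
  rw [← rpow_mul hα.le, ← rpow_mul hα.le, mul_one_div_cancel hq, rpow_one, hexp,
    rpow_neg hα.le]
  field_simp

theorem deriv_deriv_comp_rpow_one_div {q α : ℝ} (hq : q ≠ 0) (hα : 0 < α) {f : ℝ → ℝ}
    (hf : ∀ᶠ y in nhds α, DifferentiableAt ℝ f y) (hf2 : DifferentiableAt ℝ (deriv f) α) :
    deriv (deriv (fun t : ℝ => f (t ^ (1 / q)))) (α ^ q) =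
      (deriv (deriv f) α + deriv f α * ((1 - q) / α)) / (q * α ^ (q - 1)) ^ 2 := by
  have hpos : 0 < α ^ q := rpow_pos_of_pos hα q
  have hroot : (α ^ q) ^ (1 / q) = α := by
    rw [← rpow_mul hα.le, mul_one_div_cancel hq, rpow_one]
  rw [(deriv_comp_rpow_one_div_eventuallyEq hq hα hf).deriv_eq]
  have hrpow (p : ℝ) : HasDerivAt (fun t : ℝ => t ^ p) (p * (α ^ q) ^ (p - 1)) (α ^ q) :=
    hasDerivAt_rpow_const (Or.inl hpos.ne')
  have hcomp : HasDerivAt (fun t : ℝ => deriv f (t ^ (1 / q)))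
      (deriv (deriv f) α * (1 / q * (α ^ q) ^ (1 / q - 1))) (α ^ q) :=
    HasDerivAt.comp (h₂ := deriv f) (α ^ q) (by rw [hroot]; exact hf2.hasDerivAt) (hrpow (1 / q))
  rw [(hcomp.fun_mul ((hrpow (1 / q - 1)).const_mul (1 / q))).deriv]
  rw [rpow_sub_one hpos.ne' (1 / q - 1), rpow_sub_one hpos.ne' (1 / q), hroot,
    rpow_sub_one hα.ne' q]
  field_simp

/-- Theorem 4.8: if `|μ_q(α^q)| ≤ |μ(α)|` and
`(q·α^(q-1))²·(1 + (f'(α)/(q·α^(q-1)))²)^(3/2) ≤ (1 + f'(α)²)^(3/2)`, then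
`|1 + (f'(α)/f''(α))·(1-q)/α| ≤ 1` (equivalently `0 ≤ (f'(α)/f''(α))·(q-1)/α ≤ 2`),
where `g(t) = f(t^(1/q))`, `μ(α) = f''(α)/(1 + f'(α)²)^(3/2)` and
`μ_q(α^q) = g''(α^q)/(1 + g'(α^q)²)^(3/2)`. -/
theorem curvature_comparison_implies_fast_convergence (q α : ℝ) (hq : q ≠ 0)
    (hα : 0 < α) (f : ℝ → ℝ) (s : Set ℝ) (hs : s ∈ nhds α)
    (hf : ∀ y ∈ s, DifferentiableAt ℝ f y)
    (hf2 : ∀ y ∈ s, DifferentiableAt ℝ (deriv f) y)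
    (hf' : deriv f α ≠ 0) (hf'' : deriv (deriv f) α ≠ 0)
    (hμ : |deriv (deriv (fun t : ℝ => f (t ^ (1 / q)))) (α ^ q) /
          (1 + (deriv (fun t : ℝ => f (t ^ (1 / q))) (α ^ q)) ^ 2) ^ ((3 : ℝ) / 2)| ≤
        |deriv (deriv f) α / (1 + (deriv f α) ^ 2) ^ ((3 : ℝ) / 2)|)
    (hden : (q * α ^ (q - 1)) ^ 2 *
          (1 + (deriv f α / (q * α ^ (q - 1))) ^ 2) ^ ((3 : ℝ) / 2) ≤
        (1 + (deriv f α) ^ 2) ^ ((3 : ℝ) / 2)) :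
    |1 + deriv f α / deriv (deriv f) α * ((1 - q) / α)| ≤ 1 ∧
    (0 ≤ deriv f α / deriv (deriv f) α * ((q - 1) / α) ∧
      deriv f α / deriv (deriv f) α * ((q - 1) / α) ≤ 2) := by
  have hfev : ∀ᶠ y in nhds α, DifferentiableAt ℝ f y := Filter.mem_of_superset hs hf
  rw [deriv_deriv_comp_rpow_one_div hq hα hfev (hf2 α (mem_of_mem_nhds hs)),
    deriv_comp_rpow_one_div hq hα hfev] at hμ
  have hc : q * α ^ (q - 1) ≠ 0 := mul_ne_zero hq (rpow_pos_of_pos hα _).ne'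
  generalize q * α ^ (q - 1) = c at hμ hden hc
  have hDq : 0 < (1 + (deriv f α / c) ^ 2) ^ ((3 : ℝ) / 2) := rpow_pos_of_pos (by positivity) _
  have hD : 0 < (1 + (deriv f α) ^ 2) ^ ((3 : ℝ) / 2) := rpow_pos_of_pos (by positivity) _
  generalize (1 + (deriv f α / c) ^ 2) ^ ((3 : ℝ) / 2) = Dq at hμ hden hDq
  generalize (1 + (deriv f α) ^ 2) ^ ((3 : ℝ) / 2) = D at hμ hden hD
  have hc2 : 0 < c ^ 2 := by positivity
  have hnum : |deriv (deriv f) α + deriv f α * ((1 - q) / α)| ≤ |deriv (deriv f) α| := by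
    rw [div_div, abs_div, abs_div, abs_of_pos hD, abs_of_pos (mul_pos hc2 hDq),
      div_le_div_iff₀ (mul_pos hc2 hDq) hD] at hμ
    exact le_of_mul_le_mul_right
      (hμ.trans (mul_le_mul_of_nonneg_left hden (abs_nonneg _))) hD
  have hmain : |1 + deriv f α / deriv (deriv f) α * ((1 - q) / α)| ≤ 1 := by
    have hratio : 1 + deriv f α / deriv (deriv f) α * ((1 - q) / α) =
        (deriv (deriv f) α + deriv f α * ((1 - q) / α)) / deriv (deriv f) α := by
      field_simp
    rw [hratio, abs_div]
    exact div_le_one_of_le₀ hnum (abs_nonneg _)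
  have hneg : deriv f α / deriv (deriv f) α * ((1 - q) / α) =
      -(deriv f α / deriv (deriv f) α * ((q - 1) / α)) := by ring
  refine ⟨hmain, ?_⟩
  rw [hneg, abs_le] at hmain
  constructor <;> linarith [hmain.1, hmain.2]
end
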